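/- arXiv:2302.13811 — 2 statements merged into one kernel-verified Lean document; each statement's English description precedes it below -/
import Mathlib

section
/- Let u0 and u1 be moment functionals on ℂ[x] with MOPS {P_n} and {R_n} respectively, let λ ≠ 0, and let {S_n} be an MOPS relative to the Sobolev form φ_λ. Assume relation (3.1): P_{n+1} − σ̃_n P_n − τ̃_{n−1} P_{n−1} = S_{n+1} − μ_n S_n − θ_{n−1} S_{n−1} for all n ≥ 0, and assume the coefficient relations (3.2): μ_n·s_n = σ̃_n·p_n + τ̃_{n−1}·(μ_{n−1} − σ̃_{n−1})·p_{n−1} and θ_n·s_n = τ̃_n·p_n for all n ≥ 1, where p_n = ⟨u0, P_n²⟩ and s_n = φ_λ(S_n, S_n). Then {u0, u1} is a generalized coherent pair, i.e. (n+1)·R_n = P′_{n+1} − σ̃_n·P′_n − τ̃_{n−1}·P′_{n−1} for all n ≥ 0. -/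
open Polynomial

noncomputable section

/-- A monic orthogonal polynomial system (MOPS) relative to a moment functional `u`,
indexed by `ℤ` with the convention `P n = 0` for `n < 0`. -/
def IsMOPS (u : Polynomial ℂ →ₗ[ℂ] ℂ) (P : ℤ → Polynomial ℂ) : Prop :=
  (∀ n : ℤ, n < 0 → P n = 0) ∧
  (∀ n : ℤ, 0 ≤ n → (P n).Monic ∧ (P n).natDegree = n.toNat) ∧
  (∀ m n : ℤ, 0 ≤ m → 0 ≤ n → m ≠ n → u (P m * P n) = 0) ∧
  (∀ n : ℤ, 0 ≤ n → u (P n ^ 2) ≠ 0)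

/-- The Sobolev bilinear form `φ_λ(f,g) = ⟨u0, f·g⟩ + λ·⟨u1, f'·g'⟩`. -/
def sobolev (u0 u1 : Polynomial ℂ →ₗ[ℂ] ℂ) (lam : ℂ) (f g : Polynomial ℂ) : ℂ :=
  u0 (f * g) + lam * u1 (derivative f * derivative g)

/-- An MOPS relative to the Sobolev form `φ_λ`. -/
def IsSobolevMOPS (u0 u1 : Polynomial ℂ →ₗ[ℂ] ℂ) (lam : ℂ) (S : ℤ → Polynomial ℂ) : Prop :=
  (∀ n : ℤ, n < 0 → S n = 0) ∧
  (∀ n : ℤ, 0 ≤ n → (S n).Monic ∧ (S n).natDegree = n.toNat) ∧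
  (∀ m n : ℤ, 0 ≤ m → 0 ≤ n → m ≠ n → sobolev u0 u1 lam (S m) (S n) = 0) ∧
  (∀ n : ℤ, 0 ≤ n → sobolev u0 u1 lam (S n) (S n) ≠ 0)

/-- A linear functional vanishing on polynomials of each degree below `N` vanishes on all
polynomials of degree less than `N`. -/
theorem apply_eq_zero_of_degree_lt (l : ℂ[X] →ₗ[ℂ] ℂ) (F : ℕ → ℂ[X])
    (hF : ∀ k, (F k).degree = k) (N : ℕ) (h : ∀ k < N, l (F k) = 0) (f : ℂ[X])
    (hf : f.degree < N) : l f = 0 := by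
  induction N generalizing f with
  | zero =>
    have : f = 0 := by simpa using hf
    simp [this]
  | succ N ih =>
    have hne : (F N).coeff N ≠ 0 := coeff_ne_zero_of_eq_degree (hF N)
    set c := f.coeff N / (F N).coeff N with hc
    have hlt : (f - c • F N).degree < N := by
      rw [degree_lt_iff_coeff_zero] at hf ⊢
      intro m hm
      rcases hm.eq_or_lt with rfl | hm
      · simp [hc, hne]
      · have h1 : (F N).coeff m = 0 := coeff_eq_zero_of_degree_lt (by rw [hF]; exact_mod_cast hm)
        simp [hf m hm, h1]
    have h0 := ih (fun k hk => h k (by omega)) _ hlt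
    rw [map_sub, map_smul, h N (by omega), smul_zero, sub_zero] at h0
    exact h0

theorem degree_eq_of_monic_natDegree {F : ℤ → ℂ[X]}
    (hF : ∀ n : ℤ, 0 ≤ n → (F n).Monic ∧ (F n).natDegree = n.toNat) (k : ℕ) :
    (F k).degree = k := by
  obtain ⟨h1, h2⟩ := hF k (by positivity)
  rw [degree_eq_natDegree h1.ne_zero, h2]
  simp

theorem IsMOPS.apply_mul_eq_zero {u : ℂ[X] →ₗ[ℂ] ℂ} {P : ℤ → ℂ[X]} (hP : IsMOPS u P)
    (n : ℕ) {f : ℂ[X]} (hf : f.degree < n) : u (P n * f) = 0 :=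
  apply_eq_zero_of_degree_lt (u ∘ₗ LinearMap.mulLeft ℂ (P n)) (fun k => P k)
    (degree_eq_of_monic_natDegree hP.2.1) n
    (fun k hk => hP.2.2.1 n k (by positivity) (by positivity) (by exact_mod_cast hk.ne'))
    f hf

theorem IsMOPS.apply_mul_of_monic {u : ℂ[X] →ₗ[ℂ] ℂ} {P : ℤ → ℂ[X]} (hP : IsMOPS u P)
    (n : ℕ) {f : ℂ[X]} (hf : f.Monic) (hd : f.degree = n) : u (P n * f) = u (P n ^ 2) := by
  have hPd := degree_eq_of_monic_natDegree hP.2.1 n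
  have h := hP.apply_mul_eq_zero n (f := f - P n) (by
    rw [← hd]
    exact degree_sub_lt_left (hd.trans hPd.symm) hf.ne_zero
      (hf.trans (hP.2.1 n (by positivity)).1.symm))
  rw [mul_sub, map_sub, sub_eq_zero] at h
  rw [h, sq]

/-- A polynomial of degree less than `n` that is orthogonal to all such polynomials vanishes. -/
theorem IsMOPS.eq_zero_of_orthogonal {u : ℂ[X] →ₗ[ℂ] ℂ} {P : ℤ → ℂ[X]} (hP : IsMOPS u P)
    (n : ℕ) {E : ℂ[X]} (hE : E.degree < n) (h : ∀ q : ℂ[X], q.degree < n → u (E * q) = 0) :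
    E = 0 := by
  by_contra hne
  have hd := degree_eq_natDegree hne
  have h1 := hP.apply_mul_of_monic E.natDegree (monic_mul_leadingCoeff_inv hne)
    (by rw [degree_mul_leadingCoeff_inv _ hne, hd])
  have h2 := h (P E.natDegree) (by
    rwa [degree_eq_of_monic_natDegree hP.2.1, ← hd])
  apply hP.2.2.2 E.natDegree (by positivity)
  rw [← h1, ← mul_assoc, mul_comm, ← smul_eq_C_mul, map_smul, mul_comm, h2, smul_zero]

/-- A polynomial of degree at most `n` that is orthogonal to all polynomials of degree less
than `n` is a multiple of the `n`-th orthogonal polynomial. -/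
theorem IsMOPS.eq_smul_of_orthogonal {u : ℂ[X] →ₗ[ℂ] ℂ} {P : ℤ → ℂ[X]} (hP : IsMOPS u P)
    (n : ℕ) {f : ℂ[X]} (hf : f.degree ≤ n) (h : ∀ q : ℂ[X], q.degree < n → u (f * q) = 0) :
    f.coeff n • P n = f := by
  symm
  rw [← sub_eq_zero]
  refine hP.eq_zero_of_orthogonal n ?_ fun q hq => ?_
  · have hPd := degree_eq_of_monic_natDegree hP.2.1 n
    obtain ⟨hm, hn⟩ := hP.2.1 n (by positivity)
    rw [degree_lt_iff_coeff_zero]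
    intro m hm'
    rcases hm'.eq_or_lt with rfl | hm'
    · have h1 : (P n).coeff n = 1 := by simpa [Monic, leadingCoeff, hn] using hm
      simp [h1]
    · have h1 : (P n).coeff m = 0 :=
        coeff_eq_zero_of_degree_lt (by rw [hPd]; exact_mod_cast hm')
      have h2 : f.coeff m = 0 :=
        coeff_eq_zero_of_degree_lt (hf.trans_lt (by exact_mod_cast hm'))
      simp [h1, h2]
  · rw [sub_mul, map_sub, h q hq, smul_mul_assoc, map_smul, hP.apply_mul_eq_zero n hq]
    simp

theorem sobolev_sub_smul_sub_smul (u0 u1 : ℂ[X] →ₗ[ℂ] ℂ) (lam a b : ℂ) (f g h k : ℂ[X]) :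
    sobolev u0 u1 lam (f - a • g - b • h) k =
      sobolev u0 u1 lam f k - a * sobolev u0 u1 lam g k - b * sobolev u0 u1 lam h k := by
  simp only [sobolev, sub_mul, smul_mul_assoc, map_sub, map_smul, smul_eq_mul]
  ring

/-- Theorem 3.4, one direction. -/
theorem stmt6
    (u0 u1 : Polynomial ℂ →ₗ[ℂ] ℂ) (lam : ℂ) (hlam : lam ≠ 0)
    (P R S : ℤ → Polynomial ℂ)
    (hP : IsMOPS u0 P) (hR : IsMOPS u1 R) (hS : IsSobolevMOPS u0 u1 lam S)
    (σ' τ' μ θ : ℤ → ℂ) (hτ' : τ' (-1) = 0) (hθ : θ (-1) = 0)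
    (h31 : ∀ n : ℤ, 0 ≤ n →
      P (n + 1) - σ' n • P n - τ' (n - 1) • P (n - 1)
        = S (n + 1) - μ n • S n - θ (n - 1) • S (n - 1))
    (p s : ℤ → ℂ)
    (hp : ∀ n : ℤ, p n = u0 (P n ^ 2))
    (hs : ∀ n : ℤ, s n = sobolev u0 u1 lam (S n) (S n))
    (h32a : ∀ n : ℤ, 1 ≤ n →
      μ n * s n = σ' n * p n + τ' (n - 1) * (μ (n - 1) - σ' (n - 1)) * p (n - 1))
    (h32b : ∀ n : ℤ, 1 ≤ n → θ n * s n = τ' n * p n) :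
    ∀ n : ℤ, 0 ≤ n →
      ((n : ℂ) + 1) • R n
        = derivative (P (n + 1)) - σ' n • derivative (P n)
            - τ' (n - 1) • derivative (P (n - 1)) := by
  intro n hn
  lift n to ℕ using hn
  have hPd := degree_eq_of_monic_natDegree hP.2.1
  have hSd := degree_eq_of_monic_natDegree hS.2.1
  have hlow : ∀ m k : ℕ, k < m → u0 (P m * S k) = 0 := fun m k hk =>
    hP.apply_mul_eq_zero m (by rw [hSd]; exact_mod_cast hk)
  have hdiag : ∀ m : ℕ, u0 (P m * S m) = p m := fun m => by
    rw [hp]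
    exact hP.apply_mul_of_monic m (hS.2.1 m (by positivity)).1 (hSd m)
  have hpred : ∀ (F : ℤ → ℂ[X]) (m : ℕ), (∀ n : ℤ, n < 0 → F n = 0) →
      (∀ k : ℕ, (F k).degree = k) → (F ((m : ℤ) - 1)).degree < m := by
    intro F m h0 hd
    rcases m with _ | m
    · simp [h0]
    · have : ((m + 1 : ℕ) : ℤ) - 1 = m := by push_cast; ring
      rw [this, hd]
      exact_mod_cast m.lt_succ_self
  have hup : ∀ m : ℕ, u0 (P m * S (m + 1)) = (μ m - σ' m) * p m := by
    intro m
    have h1 : S ((m : ℤ) + 1) = P (m + 1) - σ' m • P m - τ' (m - 1) • P (m - 1) + μ m • S m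
        + θ (m - 1) • S (m - 1) := by
      rw [h31 m (by positivity)]; abel
    have h2 := hP.apply_mul_eq_zero m (hpred P m hP.1 hPd)
    have h3 := hP.apply_mul_eq_zero m (hpred S m hS.1 hSd)
    have h4 := hP.2.2.1 m (m + 1) (by positivity) (by positivity) (by omega)
    rw [h1]
    simp only [mul_add, mul_sub, mul_smul_comm, map_add, map_sub, map_smul, h2, h3, h4, hdiag,
      ← sq, ← hp, smul_eq_mul]
    ring
  set Q : ℂ[X] := P (n + 1) - σ' n • P n - τ' (n - 1) • P (n - 1) with hQ
  have hQS : ∀ k : ℕ, k ≤ n → u1 (derivative Q * derivative (S k)) = 0 := by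
    intro k hk
    rcases k with _ | k
    · have : (S (0 : ℕ)).natDegree = 0 := by simpa using (hS.2.1 0 le_rfl).2
      rw [derivative_of_natDegree_zero this]
      simp
    obtain ⟨m, rfl⟩ : ∃ m, n = m + 1 := ⟨n - 1, by omega⟩
    have e1 : ((m + 1 : ℕ) : ℤ) - 1 = m := by push_cast; ring
    have hφ : sobolev u0 u1 lam Q (S (k + 1 : ℕ)) = u0 (Q * S (k + 1 : ℕ)) := by
      have hu : u0 (Q * S (k + 1 : ℕ)) = - σ' (m + 1 : ℕ) * u0 (P (m + 1 : ℕ) * S (k + 1 : ℕ))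
          - τ' m * u0 (P m * S (k + 1 : ℕ)) := by
        have := hlow (m + 1 + 1) (k + 1) (by omega)
        push_cast at this
        rw [hQ, e1]
        simp [sub_mul, this]
      have hs' : sobolev u0 u1 lam Q (S (k + 1 : ℕ)) =
          - μ (m + 1 : ℕ) * sobolev u0 u1 lam (S (m + 1 : ℕ)) (S (k + 1 : ℕ))
          - θ m * sobolev u0 u1 lam (S m) (S (k + 1 : ℕ)) := by
        rw [hQ, h31 _ (by positivity), sobolev_sub_smul_sub_smul, e1,
          hS.2.2.1 _ (k + 1 : ℕ) (by positivity) (by positivity) (by push_cast; omega)]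
        ring
      rw [hu, hs']
      rcases (show k = m ∨ k + 1 = m ∨ k + 1 < m by omega) with rfl | rfl | hlt
      · have ha := h32a (k + 1 : ℕ) (by push_cast; omega)
        have hup' := hup k
        rw [e1] at ha
        rw [hdiag, hS.2.2.1 k (k + 1 : ℕ) (by positivity) (by positivity) (by push_cast; omega),
          ← hs]
        push_cast at ha hup' ⊢
        rw [hup']
        linear_combination -ha
      · have hb := h32b (k + 1 : ℕ) (by push_cast; omega)
        rw [hdiag, hlow _ _ (by omega), hS.2.2.1 (k + 1 + 1 : ℕ) (k + 1 : ℕ) (by positivity)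
          (by positivity) (by push_cast; omega), ← hs]
        linear_combination -hb
      · rw [hlow _ _ (by omega), hlow _ _ hlt, hS.2.2.1 (m + 1 : ℕ) (k + 1 : ℕ) (by positivity)
          (by positivity) (by push_cast; omega), hS.2.2.1 m (k + 1 : ℕ) (by positivity)
          (by positivity) (by push_cast; omega)]
        ring
    rw [sobolev, add_eq_left] at hφ
    exact (mul_eq_zero.mp hφ).resolve_left hlam
  have horth : ∀ q : ℂ[X], q.degree < n → u1 (derivative Q * q) = 0 := by
    intro q hq
    refine apply_eq_zero_of_degree_lt (u1 ∘ₗ LinearMap.mulLeft ℂ (derivative Q))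
      (fun k => derivative (S (k + 1 : ℕ))) (fun k => ?_) n (fun k hk => hQS (k + 1) hk) q hq
    have hnd : (S (k + 1 : ℕ)).natDegree = k + 1 := natDegree_eq_of_degree_eq_some (hSd (k + 1))
    rw [degree_derivative (by omega), hnd]
    rfl
  have hPn : (P ((n : ℤ) + 1)).natDegree = n + 1 :=
    natDegree_eq_of_degree_eq_some (by exact_mod_cast hPd (n + 1))
  have hPpred := hpred P n hP.1 hPd
  have hQdeg : Q.degree ≤ (n + 1 : ℕ) := by
    have h1 : (P ((n : ℤ) + 1)).degree ≤ (n + 1 : ℕ) := by exact_mod_cast (hPd (n + 1)).le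
    have h2 : (P n).degree ≤ (n + 1 : ℕ) := by
      rw [hPd]; exact_mod_cast n.le_succ
    have h3 : (P ((n : ℤ) - 1)).degree ≤ (n + 1 : ℕ) :=
      hPpred.le.trans (by exact_mod_cast n.le_succ)
    rw [← mem_degreeLE] at h1 h2 h3 ⊢
    exact sub_mem (sub_mem h1 (Submodule.smul_mem _ _ h2)) (Submodule.smul_mem _ _ h3)
  have hQcoeff : Q.coeff (n + 1) = 1 := by
    have h1 : (P ((n : ℤ) + 1)).coeff (n + 1) = 1 := by
      have := (hP.2.1 (n + 1) (by positivity)).1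
      rwa [Monic, leadingCoeff, hPn] at this
    have h2 : (P n).coeff (n + 1) = 0 :=
      coeff_eq_zero_of_degree_lt (by rw [hPd]; exact_mod_cast n.lt_succ_self)
    have h3 : (P ((n : ℤ) - 1)).coeff (n + 1) = 0 :=
      coeff_eq_zero_of_degree_lt (hPpred.trans (by exact_mod_cast n.lt_succ_self))
    simp [hQ, h1, h2, h3]
  have hmain := hR.eq_smul_of_orthogonal n (f := derivative Q) (by
    rw [← natDegree_le_iff_degree_le] at hQdeg ⊢
    exact (natDegree_derivative_le Q).trans (by omega)) horth
  rw [coeff_derivative, hQcoeff, one_mul] at hmain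
  simpa [hQ] using hmain
end
end

section
/- Let u0 and u1 be moment functionals on ℂ[x] with MOPS {P_n} and {R_n} respectively, set Q_n = P′_{n+1}/(n+1), and assume {Q_n} is an MOPS relative to some moment functional u. Assume the extended coherence relation: R_n − d_{n−1}R_{n−1} = Q_n − σ_{n−1}Q_{n−1} for all n ≥ 0, with d_{−1} = σ_{−1} = 0 (i.e. relation (3.9) with e_n = τ_n = 0 for all n). If σ_0 = d_0, then R_n = Q_n for all n ≥ 0 and σ_n = d_n for all n ≥ 1. -/
open Polynomial

noncomputable section

/-- Subtracting the leading multiple of a monic polynomial lowers the degree bound by one. -/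
lemma degree_sub_coeff_smul_lt {p q : ℂ[X]} {k : ℕ} (hp : p.Monic) (hpk : p.natDegree = k)
    (hq : q.degree < ((k + 1 : ℕ) : WithBot ℕ)) :
    (q - q.coeff k • p).degree < (k : WithBot ℕ) := by
  rw [degree_lt_iff_coeff_zero] at hq ⊢
  intro m hm
  rcases hm.eq_or_lt with rfl | hlt
  · have h1 : p.coeff k = 1 := by simpa [hpk] using hp.coeff_natDegree
    simp [h1]
  · have h0 : p.coeff m = 0 := coeff_eq_zero_of_natDegree_lt (by omega)
    simp [hq m hlt, h0]

namespace IsMOPS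

variable {u : ℂ[X] →ₗ[ℂ] ℂ} {P : ℤ → ℂ[X]}

lemma monic (h : IsMOPS u P) (n : ℕ) : (P n).Monic := (h.2.1 n (by omega)).1

lemma natDegree_eq (h : IsMOPS u P) (n : ℕ) : (P n).natDegree = n := by
  simpa using (h.2.1 n (by omega)).2

lemma coeff_self (h : IsMOPS u P) (n : ℕ) : (P n).coeff n = 1 := by
  have hc := (h.monic n).coeff_natDegree
  rwa [h.natDegree_eq] at hc

lemma degree_eq (h : IsMOPS u P) (n : ℕ) : (P n).degree = (n : WithBot ℕ) := by
  rw [degree_eq_natDegree (h.monic n).ne_zero, h.natDegree_eq]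

lemma degree_X_mul (h : IsMOPS u P) (n : ℕ) :
    (X * P n).degree = ((n + 1 : ℕ) : WithBot ℕ) := by
  rw [degree_mul, degree_X, h.degree_eq, add_comm]
  rfl

lemma apply_self_ne_zero (h : IsMOPS u P) (n : ℕ) : u (P n ^ 2) ≠ 0 := h.2.2.2 n (by omega)

lemma apply_mul_eq_zero_of_degree_lt (h : IsMOPS u P) {n : ℕ} {q : ℂ[X]}
    (hq : q.degree < (n : WithBot ℕ)) : u (P n * q) = 0 := by
  suffices H : ∀ k ≤ n, ∀ q : ℂ[X], q.degree < (k : WithBot ℕ) → u (P n * q) = 0 from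
    H n le_rfl q hq
  intro k
  induction k with
  | zero =>
    intro _ q hq
    have hq0 : q = 0 := by simpa [Nat.WithBot.lt_zero_iff] using hq
    simp [hq0]
  | succ k ih =>
    intro hk q hq
    have hlow := ih (by omega) _ (degree_sub_coeff_smul_lt (h.monic k) (h.natDegree_eq k) hq)
    have horth : u (P n * P k) = 0 := h.2.2.1 n k (by omega) (by omega) (by omega)
    simpa [mul_sub, horth] using hlow

lemma apply_mul_eq_coeff_mul (h : IsMOPS u P) {n : ℕ} {q : ℂ[X]}
    (hq : q.degree < ((n + 1 : ℕ) : WithBot ℕ)) : u (P n * q) = q.coeff n * u (P n ^ 2) := by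
  have hlow := h.apply_mul_eq_zero_of_degree_lt
    (degree_sub_coeff_smul_lt (h.monic n) (h.natDegree_eq n) hq)
  rw [mul_sub, map_sub, mul_smul_comm, map_smul, ← sq, smul_eq_mul] at hlow
  exact sub_eq_zero.mp hlow

lemma eq_zero_of_apply_mul_eq_zero (h : IsMOPS u P) {n : ℕ} {q : ℂ[X]}
    (hq : q.degree < (n : WithBot ℕ)) (horth : ∀ m < n, u (P m * q) = 0) : q = 0 := by
  induction n with
  | zero => simpa [Nat.WithBot.lt_zero_iff] using hq
  | succ k ih =>
    have hk := horth k (by omega)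
    rw [h.apply_mul_eq_coeff_mul hq] at hk
    have hc : q.coeff k = 0 := (mul_eq_zero.mp hk).resolve_right (h.apply_self_ne_zero k)
    have hlow := degree_sub_coeff_smul_lt (h.monic k) (h.natDegree_eq k) hq
    rw [hc, zero_smul, sub_zero] at hlow
    exact ih hlow fun m hm => horth m (by omega)

/-- The three-term recurrence relation. -/
lemma exists_three_term (h : IsMOPS u P) (n : ℕ) :
    ∃ a b : ℂ, X * P (n + 1 : ℕ) = P (n + 2 : ℕ) + a • P (n + 1 : ℕ) + b • P n := by
  have h2 := degree_sub_coeff_smul_lt (q := X * P (n + 1 : ℕ)) (h.monic (n + 2))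
    (h.natDegree_eq (n + 2)) (by rw [h.degree_X_mul]; exact_mod_cast Nat.lt_succ_self _)
  have hc : (X * P (n + 1 : ℕ)).coeff (n + 2) = 1 := by
    rw [coeff_X_mul, h.coeff_self]
  rw [hc, one_smul] at h2
  have h1 := degree_sub_coeff_smul_lt (h.monic (n + 1)) (h.natDegree_eq (n + 1)) h2
  have h0 := degree_sub_coeff_smul_lt (h.monic n) (h.natDegree_eq n) h1
  generalize (X * P (n + 1 : ℕ) - P (n + 2 : ℕ)).coeff (n + 1) = a at h0
  generalize (X * P (n + 1 : ℕ) - P (n + 2 : ℕ) - a • P (n + 1 : ℕ)).coeff n = b at h0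
  have hzero := h.eq_zero_of_apply_mul_eq_zero h0 fun m hm => ?_
  · refine ⟨a, b, ?_⟩
    rw [← sub_eq_zero, ← hzero]
    abel
  · have e : ∀ k : ℕ, m < k → u (P m * P k) = 0 := fun k hk =>
      h.2.2.1 m k (by omega) (by omega) (by omega)
    have eX : u (P m * (X * P (n + 1 : ℕ))) = 0 := by
      rw [show P m * (X * P (n + 1 : ℕ)) = P (n + 1 : ℕ) * (X * P m) by ring]
      apply h.apply_mul_eq_zero_of_degree_lt
      rw [h.degree_X_mul]
      exact_mod_cast Nat.succ_lt_succ hm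
    simp only [mul_sub, map_sub, mul_smul_comm, map_smul, eX, e (n + 2) (by omega),
      e (n + 1) (by omega), e n hm, smul_zero, sub_zero]

lemma apply_zero_eq_one (h : IsMOPS u P) : P 0 = 1 :=
  (h.monic 0).natDegree_eq_zero.mp (h.natDegree_eq 0)

/-- If two orthogonal systems agree in degree `n + 1` and differ by short linear combinations in
the next two degrees, then the coefficient of the first difference vanishes. -/
lemma eq_zero_of_perturbation {v : ℂ[X] →ₗ[ℂ] ℂ} {R Q : ℤ → ℂ[X]} (hR : IsMOPS v R)
    (hQ : IsMOPS u Q) {n : ℕ} {ε a b : ℂ} (h1 : R (n + 1 : ℕ) = Q (n + 1 : ℕ))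
    (h2 : R (n + 2 : ℕ) = Q (n + 2 : ℕ) + ε • Q (n + 1 : ℕ))
    (h3 : R (n + 3 : ℕ) = Q (n + 3 : ℕ) + a • R (n + 2 : ℕ) + b • Q (n + 2 : ℕ)) : ε = 0 := by
  obtain ⟨c, e, hrec⟩ := hR.exists_three_term (n + 1)
  rw [show n + 1 + 1 = n + 2 from rfl, show n + 1 + 2 = n + 3 from rfl, h3, h2, h1] at hrec
  have o : ∀ k : ℕ, n < k → u (Q k * Q n) = 0 := fun k hk =>
    hQ.2.2.1 k n (by omega) (by omega) (by omega)
  have oX : u (Q (n + 2 : ℕ) * (X * Q n)) = 0 := by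
    apply hQ.apply_mul_eq_zero_of_degree_lt
    rw [hQ.degree_X_mul]
    exact_mod_cast Nat.lt_succ_self _
  have oX1 : u (Q (n + 1 : ℕ) * (X * Q n)) = u (Q (n + 1 : ℕ) ^ 2) := by
    rw [hQ.apply_mul_eq_coeff_mul (by rw [hQ.degree_X_mul]; exact_mod_cast Nat.lt_succ_self _),
      coeff_X_mul, hQ.coeff_self, one_mul]
  have hl : X * (Q (n + 2 : ℕ) + ε • Q (n + 1 : ℕ)) * Q n =
      Q (n + 2 : ℕ) * (X * Q n) + ε • (Q (n + 1 : ℕ) * (X * Q n)) := by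
    simp only [smul_eq_C_mul]
    ring
  have key := congrArg (fun p => u (p * Q n)) hrec
  simp only [hl] at key
  simp only [add_mul, smul_mul_assoc, map_add, map_smul, oX, oX1, o (n + 3) (by omega),
    o (n + 2) (by omega), o (n + 1) (by omega), smul_zero, add_zero, zero_add] at key
  exact (mul_eq_zero.mp key).resolve_right (hQ.apply_self_ne_zero _)

end IsMOPS

/-- Theorem 4.1 (ii). -/
theorem stmt8
    (u0 u1 u : Polynomial ℂ →ₗ[ℂ] ℂ)
    (P R Q : ℤ → Polynomial ℂ)
    (hP : IsMOPS u0 P) (hR : IsMOPS u1 R) (hQ : IsMOPS u Q)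
    (hQdef : ∀ n : ℤ, 0 ≤ n → Q n = ((n : ℂ) + 1)⁻¹ • derivative (P (n + 1)))
    (d σ : ℤ → ℂ) (hd : d (-1) = 0) (hσ : σ (-1) = 0)
    (hrel : ∀ n : ℤ, 0 ≤ n →
      R n - d (n - 1) • R (n - 1) = Q n - σ (n - 1) • Q (n - 1))
    (hσ0 : σ 0 = d 0) :
    (∀ n : ℤ, 0 ≤ n → R n = Q n) ∧ (∀ n : ℤ, 1 ≤ n → σ n = d n) := by
  have rel : ∀ n : ℕ, R (n + 1 : ℕ) - d n • R n = Q (n + 1 : ℕ) - σ n • Q n := by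
    intro n
    simpa using hrel (n + 1 : ℕ) (by omega)
  have main : ∀ n : ℕ, R n = Q n ∧ R (n + 1 : ℕ) = Q (n + 1 : ℕ) := by
    intro n
    induction n with
    | zero =>
      have h0 : R (0 : ℕ) = Q (0 : ℕ) := hR.apply_zero_eq_one.trans hQ.apply_zero_eq_one.symm
      refine ⟨h0, ?_⟩
      have h := rel 0
      rw [h0, Nat.cast_zero, hσ0] at h
      exact sub_left_injective h
    | succ n ih =>
      obtain ⟨-, h1⟩ := ih
      refine ⟨h1, ?_⟩
      have h2 : R (n + 2 : ℕ) = Q (n + 2 : ℕ)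
          + (d (n + 1 : ℕ) - σ (n + 1 : ℕ)) • Q (n + 1 : ℕ) := by
        have h := rel (n + 1)
        rw [h1] at h
        rw [sub_eq_iff_eq_add.mp h, sub_smul]
        abel
      have h3 : R (n + 3 : ℕ) = Q (n + 3 : ℕ) + d (n + 2 : ℕ) • R (n + 2 : ℕ)
          + (-σ (n + 2 : ℕ)) • Q (n + 2 : ℕ) := by
        rw [sub_eq_iff_eq_add.mp (rel (n + 2)), neg_smul]
        abel
      rw [hR.eq_zero_of_perturbation hQ h1 h2 h3, zero_smul, add_zero] at h2
      exact h2
  constructor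
  · intro n hn
    lift n to ℕ using hn
    exact (main n).1
  · intro n hn
    lift n to ℕ using by omega
    have h := rel n
    rw [(main n).1, (main n).2] at h
    exact (smul_left_injective ℂ (hQ.monic n).ne_zero (sub_right_injective h)).symm
end
end
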